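/- arXiv:2004.07824 — 2 statements merged into one kernel-verified Lean document; each statement's English description precedes it below -/
import Mathlib

section
/- Intertwining with Θ_Y: for every f ∈ 𝒫_Y, Θ_Y(T_Z̃ f) = T_Z(Θ_Y f). (This is the relation Θ_Y(Ω_Z^{(k)} + □^{(k)}) = Ω_Z^{(k)} Θ_Y as operators on 𝒫_Y, where Ω_Z^{(k)} + □^{(k)} = (1/(1+b))·T_Z̃ and Ω_Z^{(k)} = (1/(1+b))·T_Z.) -/
open MvPolynomial

noncomputable section

/-- The base field `K = ℚ(b)`: rational functions in an indeterminate `b` over `ℚ`. -/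
abbrev K : Type := RatFunc ℚ

/-- The indeterminate `b ∈ K`. -/
def bb : K := RatFunc.X

/-- `α = 1 + b`. -/
def alpha : K := 1 + bb

/-- Variables: `p i` (used for `i ≥ 1`) and `y i`, `y' i`, `z i`, `z' i` (`i ≥ 0`). -/
inductive Var : Type
  | p : ℕ → Var
  | y : ℕ → Var
  | y' : ℕ → Var
  | z : ℕ → Var
  | z' : ℕ → Var
  deriving DecidableEq

/-- The ambient polynomial ring `R′`. -/
abbrev R : Type := MvPolynomial Var K

/-- The generic operator
`Λ_A = α Σ_{i,j≥1} i a_{i+j−1} ∂²/∂p_i∂a_{j−1} + Σ_{i,j≥1} a_{i−1} p_j ∂/∂a_{i+j−1}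
     + b Σ_{i≥1} i a_i ∂/∂a_i` for the alphabet `a ∈ {y, y′, z, z′}`. -/
def Lam (a : ℕ → Var) (f : R) : R :=
  alpha • (∑ᶠ (i : ℕ) (j : ℕ), ((i + 1 : ℕ) : K) •
      (X (a (i + j + 1)) * pderiv (Var.p (i + 1)) (pderiv (a j) f)))
    + (∑ᶠ (i : ℕ) (j : ℕ), X (a i) * X (Var.p (j + 1)) * pderiv (a (i + j + 1)) f)
    + bb • (∑ᶠ (i : ℕ), ((i + 1 : ℕ) : K) • (X (a (i + 1)) * pderiv (a (i + 1)) f))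

/-- The generic shift operator `A_+ = Σ_{i≥0} a_{i+1} ∂/∂a_i`. -/
def Plus (a : ℕ → Var) (f : R) : R := ∑ᶠ (i : ℕ), X (a (i + 1)) * pderiv (a i) f

/-- The generic operator `Θ_A = Σ_{i≥1} p_i ∂/∂a_i`. -/
def Theta (a : ℕ → Var) (f : R) : R := ∑ᶠ (i : ℕ), X (Var.p (i + 1)) * pderiv (a (i + 1)) f

/-- `M_Z = α Σ_{i,j,k≥1} y′_{i+j−1} z′_{k−1} ∂²/∂y_{i+k−1}∂z_{j−1}
         + Σ_{i,j,k≥1} y_{i+j−1} z_{k−1} ∂²/∂y′_{i+k−1}∂z′_{j−1}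
         + b Σ_{i,j,k≥1} y′_{i+j−1} z′_{k−1} ∂²/∂y′_{i+k−1}∂z′_{j−1}`. -/
def MZ (f : R) : R :=
  alpha • (∑ᶠ (i : ℕ) (j : ℕ) (k : ℕ), X (Var.y' (i + j + 1)) * X (Var.z' k) *
      pderiv (Var.y (i + k + 1)) (pderiv (Var.z j) f))
    + (∑ᶠ (i : ℕ) (j : ℕ) (k : ℕ), X (Var.y (i + j + 1)) * X (Var.z k) *
      pderiv (Var.y' (i + k + 1)) (pderiv (Var.z' j) f))
    + bb • (∑ᶠ (i : ℕ) (j : ℕ) (k : ℕ), X (Var.y' (i + j + 1)) * X (Var.z' k) *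
      pderiv (Var.y' (i + k + 1)) (pderiv (Var.z' j) f))

/-- `M_Y`: obtained from `M_Z` by exchanging `y ↔ z` and `y′ ↔ z′` everywhere. -/
def MY (f : R) : R :=
  alpha • (∑ᶠ (i : ℕ) (j : ℕ) (k : ℕ), X (Var.z' (i + j + 1)) * X (Var.y' k) *
      pderiv (Var.z (i + k + 1)) (pderiv (Var.y j) f))
    + (∑ᶠ (i : ℕ) (j : ℕ) (k : ℕ), X (Var.z (i + j + 1)) * X (Var.y k) *
      pderiv (Var.z' (i + k + 1)) (pderiv (Var.y' j) f))
    + bb • (∑ᶠ (i : ℕ) (j : ℕ) (k : ℕ), X (Var.z' (i + j + 1)) * X (Var.y' k) *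
      pderiv (Var.z' (i + k + 1)) (pderiv (Var.y' j) f))

/-- `Λ_Ỹ = Λ_Y + Λ_{Y′} + M_Y`. -/
def LamYt (f : R) : R := Lam Var.y f + Lam Var.y' f + MY f

/-- `Λ_Z̃ = Λ_Z + Λ_{Z′} + M_Z`. -/
def LamZt (f : R) : R := Lam Var.z f + Lam Var.z' f + MZ f

/-- `Ỹ_+ = Y_+ + Y′_+`. -/
def Ytplus (f : R) : R := Plus Var.y f + Plus Var.y' f

/-- `Z̃_+ = Z_+ + Z′_+`. -/
def Ztplus (f : R) : R := Plus Var.z f + Plus Var.z' f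

/-- `Θ_Z̃ = ∂/∂z₀ + Σ_{i≥1} p_i ∂/∂z_i + Σ_{i,j≥0} y_{i+j} ∂²/∂y′_i∂z′_j`. -/
def ThZt (f : R) : R :=
  pderiv (Var.z 0) f + (∑ᶠ (i : ℕ), X (Var.p (i + 1)) * pderiv (Var.z (i + 1)) f)
    + (∑ᶠ (i : ℕ) (j : ℕ), X (Var.y (i + j)) * pderiv (Var.y' i) (pderiv (Var.z' j) f))

/-- `Θ_Ỹ = ∂/∂y₀ + Σ_{i≥1} p_i ∂/∂y_i + Σ_{i,j≥0} z_{i+j} ∂²/∂z′_i∂y′_j`. -/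
def ThYt (f : R) : R :=
  pderiv (Var.y 0) f + (∑ᶠ (i : ℕ), X (Var.p (i + 1)) * pderiv (Var.y (i + 1)) f)
    + (∑ᶠ (i : ℕ) (j : ℕ), X (Var.z (i + j)) * pderiv (Var.z' i) (pderiv (Var.y' j) f))

/-- `Δ = α Σ_{i,j≥0} z′_i y′_j ∂²/∂y_i∂z_j + Σ_{i,j≥0} z_i y_j ∂²/∂y′_i∂z′_j
      + b Σ_{i,j≥0} z′_i y′_j ∂²/∂y′_i∂z′_j`. -/
def Delta (f : R) : R :=
  alpha • (∑ᶠ (i : ℕ) (j : ℕ), X (Var.z' i) * X (Var.y' j) *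
      pderiv (Var.y i) (pderiv (Var.z j) f))
    + (∑ᶠ (i : ℕ) (j : ℕ), X (Var.z i) * X (Var.y j) *
      pderiv (Var.y' i) (pderiv (Var.z' j) f))
    + bb • (∑ᶠ (i : ℕ) (j : ℕ), X (Var.z' i) * X (Var.y' j) *
      pderiv (Var.y' i) (pderiv (Var.z' j) f))

/-- `𝒫`: the subalgebra of polynomials in the `p`-variables only. -/
def Psub : Subalgebra K R := MvPolynomial.supported K (Set.range Var.p)

/-- `𝒫_Y`: the `K`-linear span of the monomials `p_λ` and `y_i·p_λ`. -/
def PY : Submodule K R :=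
  Submodule.span K ((Psub : Set R) ∪
    {g : R | ∃ i : ℕ, ∃ f ∈ (Psub : Set R), g = X (Var.y i) * f})

/-- `𝒫_{Ỹ,Z̃}`: the `K`-linear span of the monomials
`p_λ, y_i·p_λ, z_j·p_λ, y_i·z_j·p_λ, y′_i·p_λ, z′_j·p_λ, y′_i·z′_j·p_λ`. -/
def PYZt : Submodule K R :=
  Submodule.span K ((Psub : Set R) ∪
    {g : R | ∃ f ∈ (Psub : Set R),
      (∃ i : ℕ, g = X (Var.y i) * f) ∨ (∃ j : ℕ, g = X (Var.z j) * f) ∨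
      (∃ i : ℕ, ∃ j : ℕ, g = X (Var.y i) * X (Var.z j) * f) ∨
      (∃ i : ℕ, g = X (Var.y' i) * f) ∨ (∃ j : ℕ, g = X (Var.z' j) * f) ∨
      (∃ i : ℕ, ∃ j : ℕ, g = X (Var.y' i) * X (Var.z' j) * f)})

/-- `Λ_Z̃ + u`: the operator `f ↦ Λ_Z̃ f + u·f`. -/
def LuZt (u : K) (f : R) : R := LamZt f + u • f

/-- `Λ_Z + u`: the operator `f ↦ Λ_Z f + u·f`. -/
def LuZ (u : K) (f : R) : R := Lam Var.z f + u • f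

/-- `Λ_Y + u`: the operator `f ↦ Λ_Y f + u·f`. -/
def LuY (u : K) (f : R) : R := Lam Var.y f + u • f

/-- The composition `(Λ_Z̃+u₁) ∘ ⋯ ∘ (Λ_Z̃+u_k)`. -/
def prodLuZt (k : ℕ) (u : Fin k → K) : R → R :=
  (List.ofFn (fun i => LuZt (u i))).foldr (fun g h => g ∘ h) (id : R → R)

/-- The composition `(Λ_Z+u₁) ∘ ⋯ ∘ (Λ_Z+u_k)`. -/
def prodLuZ (k : ℕ) (u : Fin k → K) : R → R :=
  (List.ofFn (fun i => LuZ (u i))).foldr (fun g h => g ∘ h) (id : R → R)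

/-- The composition `(Λ_Y+u₁) ∘ ⋯ ∘ (Λ_Y+u_k)`. -/
def prodLuY (k : ℕ) (u : Fin k → K) : R → R :=
  (List.ofFn (fun i => LuY (u i))).foldr (fun g h => g ∘ h) (id : R → R)

/-- `T_Z̃ g = Θ_Z̃(Z̃_+((Λ_Z̃+u₁)⋯(Λ_Z̃+u_k)(Λ_Z̃(z₀·g))))`. -/
def TZt (k : ℕ) (u : Fin k → K) (g : R) : R :=
  ThZt (Ztplus (prodLuZt k u (LamZt (X (Var.z 0) * g))))

/-- `T_Z g = Θ_Z(Z_+((Λ_Z+u₁)⋯(Λ_Z+u_k)(Λ_Z(z₀·g))))`. -/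
def TZ (k : ℕ) (u : Fin k → K) (g : R) : R :=
  Theta Var.z (Plus Var.z (prodLuZ k u (Lam Var.z (X (Var.z 0) * g))))

/-- `W g = Y_+((Λ_Y+u₁)⋯(Λ_Y+u_k) g)`. -/
def Wo (k : ℕ) (u : Fin k → K) (g : R) : R := Plus Var.y (prodLuY k u g)

/-! ### Locally finite sums of linear operators -/

lemma exists_bound_pderiv {a : ℕ → Var} (ha : Function.Injective a) (f : R) :
    ∃ N, ∀ n ≥ N, pderiv (a n) f = 0 := by
  have hfin : (a ⁻¹' (f.vars : Set Var)).Finite :=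
    (Finset.finite_toSet f.vars).preimage ha.injOn
  obtain ⟨N, hN⟩ := hfin.bddAbove
  refine ⟨N + 1, fun n hn => pderiv_eq_zero_of_notMem_vars fun hmem => ?_⟩
  have := hN (show n ∈ a ⁻¹' (f.vars : Set Var) from hmem)
  omega

lemma pderiv_comm (v w : Var) (f : R) : pderiv v (pderiv w f) = pderiv w (pderiv v f) := by
  have h : ⁅(pderiv v : Derivation K R R), (pderiv w : Derivation K R R)⁆ = 0 := by
    refine MvPolynomial.derivation_ext fun i => ?_
    rw [Derivation.commutator_apply, pderiv_X, pderiv_X, Pi.single_apply, Pi.single_apply]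
    split_ifs <;> simp
  have := DFunLike.congr_fun h f
  rwa [Derivation.commutator_apply, Derivation.zero_apply, sub_eq_zero] at this

lemma finsum_eq_sum_range {F : ℕ → R} {N : ℕ} (h : ∀ n ≥ N, F n = 0) :
    ∑ᶠ i, F i = ∑ i ∈ Finset.range N, F i := by
  refine finsum_eq_sum_of_support_subset _ fun i hi => ?_
  by_contra hlt
  exact hi (h i (by simpa using hlt))

lemma isLinearMap_finsum {L : ℕ → R → R} (hL : ∀ i, IsLinearMap K (L i))
    (hfin : ∀ f, ∃ N, ∀ i ≥ N, L i f = 0) : IsLinearMap K fun f => ∑ᶠ i, L i f := by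
  constructor
  · intro f g
    obtain ⟨N, hN⟩ := hfin f
    obtain ⟨M, hM⟩ := hfin g
    rw [finsum_eq_sum_range (N := max N M) fun n hn => hN n (by omega),
      finsum_eq_sum_range (N := max N M) fun n hn => hM n (by omega),
      finsum_eq_sum_range (N := max N M) fun n hn => by
        rw [(hL n).map_add, hN n (by omega), hM n (by omega), add_zero],
      ← Finset.sum_add_distrib]
    exact Finset.sum_congr rfl fun i _ => (hL i).map_add f g
  · intro c f
    obtain ⟨N, hN⟩ := hfin f
    rw [finsum_eq_sum_range hN,
      finsum_eq_sum_range (N := N) fun n hn => by rw [(hL n).map_smul, hN n hn, smul_zero],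
      Finset.smul_sum]
    exact Finset.sum_congr rfl fun i _ => (hL i).map_smul c f

lemma IsLinearMap.add_op {S T : R → R} (hS : IsLinearMap K S) (hT : IsLinearMap K T) :
    IsLinearMap K fun f => S f + T f := (hS.mk' S + hT.mk' T).isLinear

lemma IsLinearMap.smul_op {S : R → R} (c : K) (hS : IsLinearMap K S) :
    IsLinearMap K fun f => c • S f := (c • hS.mk' S).isLinear

lemma IsLinearMap.comp_op {S T : R → R} (hS : IsLinearMap K S) (hT : IsLinearMap K T) :
    IsLinearMap K fun f => S (T f) := (hS.mk' S ∘ₗ hT.mk' T).isLinear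

lemma isLinearMap_mul_pderiv (q : R) (v : Var) : IsLinearMap K fun f : R => q * pderiv v f :=
  (LinearMap.mulLeft K q ∘ₗ (pderiv v).toLinearMap).isLinear

lemma isLinearMap_mul_pderiv_pderiv (q : R) (v w : Var) :
    IsLinearMap K fun f : R => q * pderiv v (pderiv w f) :=
  (isLinearMap_mul_pderiv q v).comp_op (pderiv w).toLinearMap.isLinear

lemma injective_p : Function.Injective Var.p := fun _ _ h => Var.p.inj h
lemma injective_y : Function.Injective Var.y := fun _ _ h => Var.y.inj h
lemma injective_y' : Function.Injective Var.y' := fun _ _ h => Var.y'.inj h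
lemma injective_z : Function.Injective Var.z := fun _ _ h => Var.z.inj h
lemma injective_z' : Function.Injective Var.z' := fun _ _ h => Var.z'.inj h

/-- The trilinear sum `Σ c_{i+j+1} d_k ∂²/∂a_{i+k+1}∂e_j` occurring in `M_Z`. -/
def crossSum (c d a e : ℕ → Var) (f : R) : R :=
  ∑ᶠ (i : ℕ) (j : ℕ) (k : ℕ), X (c (i + j + 1)) * X (d k) *
    pderiv (a (i + k + 1)) (pderiv (e j) f)

lemma isLinearMap_crossSum (c d : ℕ → Var) {a e : ℕ → Var} (ha : Function.Injective a)
    (he : Function.Injective e) : IsLinearMap K (crossSum c d a e) := by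
  refine isLinearMap_finsum (fun i => isLinearMap_finsum (fun j => isLinearMap_finsum
    (fun k => isLinearMap_mul_pderiv_pderiv _ _ _) fun f => ?_) fun f => ?_) fun f => ?_
  · obtain ⟨N, hN⟩ := exists_bound_pderiv ha (pderiv (e j) f)
    exact ⟨N, fun k hk => by rw [hN _ (by omega), mul_zero]⟩
  · obtain ⟨N, hN⟩ := exists_bound_pderiv he f
    exact ⟨N, fun k hk => by simp [hN k hk]⟩
  · obtain ⟨N, hN⟩ := exists_bound_pderiv ha f
    refine ⟨N, fun i hi => ?_⟩
    have h0 (j k : ℕ) : pderiv (a (i + k + 1)) (pderiv (e j) f) = 0 := by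
      rw [pderiv_comm, hN _ (by omega), map_zero]
    simp [h0]

lemma isLinearMap_MZ : IsLinearMap K MZ :=
  (((isLinearMap_crossSum Var.y' Var.z' injective_y injective_z).smul_op alpha).add_op
    (isLinearMap_crossSum Var.y Var.z injective_y' injective_z')).add_op
    ((isLinearMap_crossSum Var.y' Var.z' injective_y' injective_z').smul_op bb)

lemma isLinearMap_Lam {a : ℕ → Var} (ha : Function.Injective a) : IsLinearMap K (Lam a) := by
  refine ((IsLinearMap.smul_op alpha ?_).add_op ?_).add_op (IsLinearMap.smul_op bb ?_)
  · refine isLinearMap_finsum (fun i => isLinearMap_finsum (fun j =>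
      (isLinearMap_mul_pderiv_pderiv _ _ _).smul_op _) fun f => ?_) fun f => ?_
    · obtain ⟨N, hN⟩ := exists_bound_pderiv ha f
      exact ⟨N, fun k hk => by simp [hN k hk]⟩
    · obtain ⟨N, hN⟩ := exists_bound_pderiv injective_p f
      refine ⟨N, fun i hi => ?_⟩
      have h0 (j : ℕ) : pderiv (Var.p (i + 1)) (pderiv (a j) f) = 0 := by
        rw [pderiv_comm, hN _ (by omega), map_zero]
      simp [h0]
  · refine isLinearMap_finsum (fun i => isLinearMap_finsum (fun j =>
      isLinearMap_mul_pderiv _ _) fun f => ?_) fun f => ?_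
    all_goals obtain ⟨N, hN⟩ := exists_bound_pderiv ha f
    · exact ⟨N, fun k hk => by rw [hN _ (by omega), mul_zero]⟩
    · refine ⟨N, fun i hi => ?_⟩
      have h0 (j : ℕ) : pderiv (a (i + j + 1)) f = 0 := hN _ (by omega)
      simp [h0]
  · refine isLinearMap_finsum (fun i => (isLinearMap_mul_pderiv _ _).smul_op _) fun f => ?_
    obtain ⟨N, hN⟩ := exists_bound_pderiv ha f
    exact ⟨N, fun k hk => by rw [hN _ (by omega), mul_zero, smul_zero]⟩

lemma isLinearMap_LamZt : IsLinearMap K LamZt :=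
  ((isLinearMap_Lam injective_z).add_op (isLinearMap_Lam injective_z')).add_op isLinearMap_MZ

lemma isLinearMap_Plus {a : ℕ → Var} (ha : Function.Injective a) : IsLinearMap K (Plus a) := by
  refine isLinearMap_finsum (fun i => isLinearMap_mul_pderiv _ _) fun f => ?_
  obtain ⟨N, hN⟩ := exists_bound_pderiv ha f
  exact ⟨N, fun k hk => by rw [hN _ (by omega), mul_zero]⟩

lemma isLinearMap_Theta {a : ℕ → Var} (ha : Function.Injective a) :
    IsLinearMap K (Theta a) := by
  refine isLinearMap_finsum (fun i => isLinearMap_mul_pderiv _ _) fun f => ?_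
  obtain ⟨N, hN⟩ := exists_bound_pderiv ha f
  exact ⟨N, fun k hk => by rw [hN _ (by omega), mul_zero]⟩

lemma isLinearMap_contraction (c : ℕ → Var) {a e : ℕ → Var} (ha : Function.Injective a)
    (he : Function.Injective e) : IsLinearMap K fun f : R =>
      ∑ᶠ (i : ℕ) (j : ℕ), X (c (i + j)) * pderiv (a i) (pderiv (e j) f) := by
  refine isLinearMap_finsum (fun i => isLinearMap_finsum (fun j =>
    isLinearMap_mul_pderiv_pderiv _ _ _) fun f => ?_) fun f => ?_
  · obtain ⟨N, hN⟩ := exists_bound_pderiv he f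
    exact ⟨N, fun k hk => by simp [hN k hk]⟩
  · obtain ⟨N, hN⟩ := exists_bound_pderiv ha f
    refine ⟨N, fun i hi => ?_⟩
    have h0 (j : ℕ) : pderiv (a i) (pderiv (e j) f) = 0 := by
      rw [pderiv_comm, hN _ hi, map_zero]
    simp [h0]

lemma isLinearMap_ThZt : IsLinearMap K ThZt :=
  ((pderiv (Var.z 0)).toLinearMap.isLinear.add_op (isLinearMap_Theta injective_z)).add_op
    (isLinearMap_contraction Var.y injective_y' injective_z')

lemma isLinearMap_Ztplus : IsLinearMap K Ztplus :=
  (isLinearMap_Plus injective_z).add_op (isLinearMap_Plus injective_z')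

/-! ### Values of the operators on monomials -/

lemma pderiv_X_mul_self {v : Var} {h : R} (hv : pderiv v h = 0) : pderiv v (X v * h) = h := by
  simp [hv]

lemma pderiv_X_mul_of_ne {v w : Var} (hne : w ≠ v) (h : R) :
    pderiv v (X w * h) = X w * pderiv v h := by
  simp [pderiv_X_of_ne hne]

lemma pderiv_letter_X_mul {a : ℕ → Var} (ha : Function.Injective a) {h : R}
    (hh : ∀ n, pderiv (a n) h = 0) (n j : ℕ) :
    pderiv (a n) (X (a j) * h) = if n = j then h else 0 := by
  split_ifs with hnj
  · subst hnj
    exact pderiv_X_mul_self (hh n)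
  · rw [pderiv_X_mul_of_ne (fun heq => hnj (ha heq).symm), hh, mul_zero]

lemma Lam_eq_zero {a : ℕ → Var} {f : R} (h : ∀ n, pderiv (a n) f = 0) : Lam a f = 0 := by
  simp [Lam, h]

lemma Plus_eq_zero {a : ℕ → Var} {f : R} (h : ∀ n, pderiv (a n) f = 0) : Plus a f = 0 := by
  simp [Plus, h]

lemma Theta_eq_zero {a : ℕ → Var} {f : R} (h : ∀ n, pderiv (a n) f = 0) : Theta a f = 0 := by
  simp [Theta, h]

lemma Lam_X_mul {a : ℕ → Var} (ha : Function.Injective a) {h : R}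
    (hh : ∀ n, pderiv (a n) h = 0) {N : ℕ} (hN : ∀ n ≥ N, pderiv (Var.p n) h = 0) (j : ℕ) :
    Lam a (X (a j) * h) =
      alpha • (∑ i ∈ Finset.range N,
        ((i + 1 : ℕ) : K) • (X (a (i + j + 1)) * pderiv (Var.p (i + 1)) h))
      + (∑ m ∈ Finset.range j, X (a m) * X (Var.p (j - m)) * h)
      + bb • ((j : K) • (X (a j) * h)) := by
  unfold Lam
  simp only [pderiv_letter_X_mul ha hh]
  congr 1
  · congr 1
    · congr 1
      rw [finsum_eq_sum_range (N := N)]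
      · refine Finset.sum_congr rfl fun i _ => ?_
        rw [finsum_eq_single _ j fun m hm => by simp [hm], if_pos rfl]
      · intro i hi
        rw [finsum_eq_single _ j fun m hm => by simp [hm], if_pos rfl, hN _ (by omega),
          mul_zero, smul_zero]
    · rw [finsum_eq_sum_range (N := j)]
      · refine Finset.sum_congr rfl fun i hi => ?_
        have hi' := Finset.mem_range.1 hi
        rw [finsum_eq_single _ (j - i - 1) fun m hm => by
          rw [if_neg (by omega), mul_zero], if_pos (by omega)]
        congr 4
        omega
      · intro i hi
        have h0 (m : ℕ) : ¬ (i + m + 1 = j) := by omega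
        simp [h0]
  · congr 1
    rcases j with _ | j
    · simp
    · rw [finsum_eq_single _ j fun m hm => by simp [hm], if_pos rfl]

lemma Plus_X_mul {a : ℕ → Var} (ha : Function.Injective a) {h : R}
    (hh : ∀ n, pderiv (a n) h = 0) (j : ℕ) :
    Plus a (X (a j) * h) = X (a (j + 1)) * h := by
  unfold Plus
  simp only [pderiv_letter_X_mul ha hh]
  rw [finsum_eq_single _ j fun m hm => by simp [hm], if_pos rfl]

lemma Theta_X_succ_mul {a : ℕ → Var} (ha : Function.Injective a) {h : R}
    (hh : ∀ n, pderiv (a n) h = 0) (j : ℕ) :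
    Theta a (X (a (j + 1)) * h) = X (Var.p (j + 1)) * h := by
  unfold Theta
  simp only [pderiv_letter_X_mul ha hh]
  rw [finsum_eq_single _ j fun m hm => by simp [hm], if_pos rfl]

lemma Theta_X_zero_mul {a : ℕ → Var} (ha : Function.Injective a) {h : R}
    (hh : ∀ n, pderiv (a n) h = 0) : Theta a (X (a 0) * h) = 0 := by
  unfold Theta
  simp only [pderiv_letter_X_mul ha hh]
  simp

lemma crossSum_eq_zero {c d a e : ℕ → Var} {f : R}
    (h : ∀ n m, pderiv (a n) (pderiv (e m) f) = 0) : crossSum c d a e f = 0 := by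
  simp [crossSum, h]

lemma crossSum_X_mul_X_mul (c d : ℕ → Var) {a e : ℕ → Var} (ha : Function.Injective a)
    (he : Function.Injective e) (hae : ∀ n m, a n ≠ e m) {h : R}
    (hah : ∀ n, pderiv (a n) h = 0) (heh : ∀ n, pderiv (e n) h = 0) (s t : ℕ) :
    crossSum c d a e (X (e t) * (X (a s) * h)) =
      ∑ i ∈ Finset.range s, X (c (i + t + 1)) * X (d (s - 1 - i)) * h := by
  have heh' (n : ℕ) : pderiv (e n) (X (a s) * h) = 0 := by
    rw [pderiv_X_mul_of_ne (hae s n), heh, mul_zero]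
  unfold crossSum
  simp only [pderiv_letter_X_mul he heh']
  have inner (i : ℕ) : (∑ᶠ (j : ℕ) (k : ℕ), X (c (i + j + 1)) * X (d k) *
      pderiv (a (i + k + 1)) (if j = t then X (a s) * h else 0)) =
      ∑ᶠ k : ℕ, X (c (i + t + 1)) * X (d k) * (if i + k + 1 = s then h else 0) := by
    rw [finsum_eq_single _ t fun m hm => by simp [hm], if_pos rfl]
    simp only [pderiv_letter_X_mul ha hah]
  simp only [inner]
  rw [finsum_eq_sum_range (N := s)]
  · refine Finset.sum_congr rfl fun i hi => ?_
    have hi' := Finset.mem_range.1 hi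
    rw [finsum_eq_single _ (s - 1 - i) fun m hm => by
      rw [if_neg (by omega), mul_zero], if_pos (by omega)]
  · intro i hi
    have h0 (m : ℕ) : ¬ (i + m + 1 = s) := by omega
    simp [h0]

lemma contraction_X_mul_X_mul (c : ℕ → Var) {a e : ℕ → Var} (ha : Function.Injective a)
    (he : Function.Injective e) (hae : ∀ n m, a n ≠ e m) {h : R}
    (hah : ∀ n, pderiv (a n) h = 0) (heh : ∀ n, pderiv (e n) h = 0) (s t : ℕ) :
    (∑ᶠ (i : ℕ) (j : ℕ), X (c (i + j)) *
      pderiv (a i) (pderiv (e j) (X (e t) * (X (a s) * h)))) = X (c (s + t)) * h := by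
  have heh' (n : ℕ) : pderiv (e n) (X (a s) * h) = 0 := by
    rw [pderiv_X_mul_of_ne (hae s n), heh, mul_zero]
  simp only [pderiv_letter_X_mul he heh']
  have inner (i : ℕ) : (∑ᶠ j : ℕ, X (c (i + j)) *
      pderiv (a i) (if j = t then X (a s) * h else 0)) =
      X (c (i + t)) * (if i = s then h else 0) := by
    rw [finsum_eq_single _ t fun m hm => by simp [hm], if_pos rfl,
      pderiv_letter_X_mul ha hah]
  simp only [inner]
  rw [finsum_eq_single _ s fun m hm => by simp [hm], if_pos rfl]

/-! ### The transfer map from `Λ_Z̃` to `Λ_Z` -/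

/-- No variable other than the `p_i` occurs in `g`. -/
structure IsPFree (g : R) : Prop where
  y : ∀ n, pderiv (Var.y n) g = 0
  y' : ∀ n, pderiv (Var.y' n) g = 0
  z : ∀ n, pderiv (Var.z n) g = 0
  z' : ∀ n, pderiv (Var.z' n) g = 0

lemma isPFree_of_mem_Psub {g : R} (hg : g ∈ Psub) : IsPFree g := by
  have h (v : Var) (hv : v ∉ Set.range Var.p) : pderiv v g = 0 :=
    pderiv_eq_zero_of_notMem_vars fun hmem => hv (mem_supported.1 hg hmem)
  constructor <;> intro n <;> exact h _ (by simp)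

lemma IsPFree.X_p_mul {g : R} (hg : IsPFree g) (n : ℕ) : IsPFree (X (Var.p n) * g) := by
  constructor <;> intro m <;> rw [pderiv_X_mul_of_ne (by simp)]
  · rw [hg.y, mul_zero]
  · rw [hg.y', mul_zero]
  · rw [hg.z, mul_zero]
  · rw [hg.z', mul_zero]

lemma IsPFree.pderiv {g : R} (hg : IsPFree g) (v : Var) :
    IsPFree (MvPolynomial.pderiv v g) := by
  constructor <;> intro m <;> rw [pderiv_comm]
  · rw [hg.y, map_zero]
  · rw [hg.y', map_zero]
  · rw [hg.z, map_zero]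
  · rw [hg.z', map_zero]

/-- The span of the monomials `z_j·p_λ`, `y_i·z_j·p_λ` and `y′_i·z′_j·p_λ`. -/
def spanZt : Submodule K R :=
  Submodule.span K {F : R | ∃ g, IsPFree g ∧
    ((∃ j, F = X (Var.z j) * g) ∨ (∃ i j, F = X (Var.z j) * (X (Var.y i) * g)) ∨
      (∃ i j, F = X (Var.z' j) * (X (Var.y' i) * g)))}

lemma z_mem_spanZt {g : R} (hg : IsPFree g) (j : ℕ) : X (Var.z j) * g ∈ spanZt :=
  Submodule.subset_span ⟨g, hg, Or.inl ⟨j, rfl⟩⟩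

lemma zy_mem_spanZt {g : R} (hg : IsPFree g) (i j : ℕ) :
    X (Var.z j) * (X (Var.y i) * g) ∈ spanZt :=
  Submodule.subset_span ⟨g, hg, Or.inr (Or.inl ⟨i, j, rfl⟩)⟩

lemma zy'_mem_spanZt {g : R} (hg : IsPFree g) (i j : ℕ) :
    X (Var.z' j) * (X (Var.y' i) * g) ∈ spanZt :=
  Submodule.subset_span ⟨g, hg, Or.inr (Or.inr ⟨i, j, rfl⟩)⟩

/-- The operator `Θ_Y + Σ_{i,j≥0} z_{i+j} ∂²/∂y′_i∂z′_j`. -/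
def transfer : R →ₗ[K] R :=
  ((isLinearMap_Theta injective_y).add_op
    (isLinearMap_contraction Var.z injective_y' injective_z')).mk' _

lemma transfer_apply (f : R) : transfer f = Theta Var.y f +
    ∑ᶠ (i : ℕ) (j : ℕ), X (Var.z (i + j)) * pderiv (Var.y' i) (pderiv (Var.z' j) f) := rfl

lemma transfer_z {g : R} (hg : IsPFree g) (j : ℕ) : transfer (X (Var.z j) * g) = 0 := by
  rw [transfer_apply, Theta_eq_zero]
  · simp [hg.z']
  · simp [hg.y]

lemma transfer_zy {g : R} (hg : IsPFree g) (i j : ℕ) :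
    transfer (X (Var.z j) * (X (Var.y i) * g)) =
      X (Var.z j) * ((if i = 0 then 0 else X (Var.p i)) * g) := by
  have h1 : X (Var.z j) * (X (Var.y i) * g) = X (Var.y i) * (X (Var.z j) * g) := by ring
  have h2 (n : ℕ) : pderiv (Var.y n) (X (Var.z j) * g) = 0 := by simp [hg.y]
  have h3 (n : ℕ) : pderiv (Var.z' n) (X (Var.y i) * (X (Var.z j) * g)) = 0 := by simp [hg.z']
  rw [transfer_apply, h1]
  simp only [h3, map_zero, mul_zero, finsum_zero, add_zero]
  rcases i with _ | i
  · rw [Theta_X_zero_mul injective_y h2]; simp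
  · rw [Theta_X_succ_mul injective_y h2, if_neg (Nat.succ_ne_zero i)]; ring

lemma transfer_zy' {g : R} (hg : IsPFree g) (i j : ℕ) :
    transfer (X (Var.z' j) * (X (Var.y' i) * g)) = X (Var.z (i + j)) * g := by
  rw [transfer_apply, Theta_eq_zero, contraction_X_mul_X_mul _ injective_y' injective_z'
    (by simp) hg.y' hg.z', zero_add]
  simp [hg.y]

lemma MZ_eq (f : R) : MZ f = alpha • crossSum Var.y' Var.z' Var.y Var.z f
    + crossSum Var.y Var.z Var.y' Var.z' f + bb • crossSum Var.y' Var.z' Var.y' Var.z' f := rfl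

lemma LamZt_z {g : R} (hg : IsPFree g) {N : ℕ} (hN : ∀ n ≥ N, pderiv (Var.p n) g = 0) (j : ℕ) :
    LamZt (X (Var.z j) * g) =
      alpha • (∑ i ∈ Finset.range N,
        ((i + 1 : ℕ) : K) • (X (Var.z (i + j + 1)) * pderiv (Var.p (i + 1)) g))
      + (∑ m ∈ Finset.range j, X (Var.z m) * (X (Var.p (j - m)) * g))
      + bb • ((j : K) • (X (Var.z j) * g)) := by
  rw [LamZt, MZ_eq, Lam_eq_zero (a := Var.z') (by simp [hg.z']),
    crossSum_eq_zero (fun n m => by rw [pderiv_comm]; simp [hg.y]),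
    crossSum_eq_zero (by simp [hg.z']), crossSum_eq_zero (by simp [hg.z']),
    Lam_X_mul injective_z hg.z hN]
  simp only [mul_assoc, smul_zero, add_zero]

lemma LamZt_zy {g : R} (hg : IsPFree g) {N : ℕ} (hN : ∀ n ≥ N, pderiv (Var.p n) g = 0)
    (i j : ℕ) :
    LamZt (X (Var.z j) * (X (Var.y i) * g)) =
      alpha • (∑ m ∈ Finset.range N, ((m + 1 : ℕ) : K) •
        (X (Var.z (m + j + 1)) * (X (Var.y i) * pderiv (Var.p (m + 1)) g)))
      + (∑ m ∈ Finset.range j, X (Var.z m) * (X (Var.y i) * (X (Var.p (j - m)) * g)))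
      + bb • ((j : K) • (X (Var.z j) * (X (Var.y i) * g)))
      + alpha • ∑ m ∈ Finset.range i,
          X (Var.z' (i - 1 - m)) * (X (Var.y' (m + j + 1)) * g) := by
  have hp (n : ℕ) : pderiv (Var.p n) (X (Var.y i) * g) = X (Var.y i) * pderiv (Var.p n) g :=
    pderiv_X_mul_of_ne (by simp) g
  rw [LamZt, MZ_eq, Lam_eq_zero (a := Var.z') (by simp [hg.z']),
    crossSum_X_mul_X_mul _ _ injective_y injective_z (by simp) hg.y hg.z,
    crossSum_eq_zero (by simp [hg.z']), crossSum_eq_zero (by simp [hg.z']),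
    Lam_X_mul injective_z (by simp [hg.z]) (N := N) (fun n hn => by rw [hp, hN n hn, mul_zero])]
  simp only [hp, smul_zero, add_zero]
  congr 1
  · congr 2
    exact Finset.sum_congr rfl fun m _ => by ring
  · congr 1
    exact Finset.sum_congr rfl fun m _ => by ring

lemma LamZt_zy' {g : R} (hg : IsPFree g) {N : ℕ} (hN : ∀ n ≥ N, pderiv (Var.p n) g = 0)
    (i j : ℕ) :
    LamZt (X (Var.z' j) * (X (Var.y' i) * g)) =
      alpha • (∑ m ∈ Finset.range N, ((m + 1 : ℕ) : K) •
        (X (Var.z' (m + j + 1)) * (X (Var.y' i) * pderiv (Var.p (m + 1)) g)))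
      + (∑ m ∈ Finset.range j, X (Var.z' m) * (X (Var.y' i) * (X (Var.p (j - m)) * g)))
      + bb • ((j : K) • (X (Var.z' j) * (X (Var.y' i) * g)))
      + (∑ m ∈ Finset.range i, X (Var.z (i - 1 - m)) * (X (Var.y (m + j + 1)) * g))
      + bb • ∑ m ∈ Finset.range i,
          X (Var.z' (i - 1 - m)) * (X (Var.y' (m + j + 1)) * g) := by
  have hp (n : ℕ) : pderiv (Var.p n) (X (Var.y' i) * g) = X (Var.y' i) * pderiv (Var.p n) g :=
    pderiv_X_mul_of_ne (by simp) g
  rw [LamZt, MZ_eq, Lam_eq_zero (a := Var.z) (by simp [hg.z]),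
    crossSum_eq_zero (c := Var.y') (a := Var.y) (by simp [hg.z]),
    crossSum_X_mul_X_mul Var.y _ injective_y' injective_z' (by simp) hg.y' hg.z',
    crossSum_X_mul_X_mul Var.y' _ injective_y' injective_z' (by simp) hg.y' hg.z',
    Lam_X_mul injective_z' (by simp [hg.z']) (N := N)
      (fun n hn => by rw [hp, hN n hn, mul_zero])]
  simp only [hp, smul_zero, zero_add, ← add_assoc]
  have hB : ∑ m ∈ Finset.range j, X (Var.z' m) * X (Var.p (j - m)) * (X (Var.y' i) * g) =
      ∑ m ∈ Finset.range j, X (Var.z' m) * (X (Var.y' i) * (X (Var.p (j - m)) * g)) :=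
    Finset.sum_congr rfl fun m _ => by ring
  have hC (c d : ℕ → Var) : ∑ m ∈ Finset.range i, X (c (m + j + 1)) * X (d (i - 1 - m)) * g =
      ∑ m ∈ Finset.range i, X (d (i - 1 - m)) * (X (c (m + j + 1)) * g) :=
    Finset.sum_congr rfl fun m _ => by ring
  rw [hB, hC, hC]

lemma LamZt_mem_spanZt {F : R} (hF : F ∈ spanZt) : LamZt F ∈ spanZt := by
  suffices h : spanZt ≤ spanZt.comap (isLinearMap_LamZt.mk' LamZt) from h hF
  refine Submodule.span_le.2 ?_
  rintro _ ⟨g, hg, ⟨j, rfl⟩ | ⟨i, j, rfl⟩ | ⟨i, j, rfl⟩⟩ <;>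
    obtain ⟨N, hN⟩ := exists_bound_pderiv injective_p g
  · change LamZt _ ∈ spanZt
    rw [LamZt_z hg hN]
    refine add_mem (add_mem (Submodule.smul_mem _ _ (sum_mem fun m _ =>
      Submodule.smul_mem _ _ ?_)) (sum_mem fun m _ => ?_))
      (Submodule.smul_mem _ _ (Submodule.smul_mem _ _ ?_))
    · exact z_mem_spanZt (hg.pderiv _) _
    · exact z_mem_spanZt (hg.X_p_mul _) _
    · exact z_mem_spanZt hg _
  · change LamZt _ ∈ spanZt
    rw [LamZt_zy hg hN]
    refine add_mem (add_mem (add_mem (Submodule.smul_mem _ _ (sum_mem fun m _ =>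
      Submodule.smul_mem _ _ ?_)) (sum_mem fun m _ => ?_))
      (Submodule.smul_mem _ _ (Submodule.smul_mem _ _ ?_)))
      (Submodule.smul_mem _ _ (sum_mem fun m _ => ?_))
    · exact zy_mem_spanZt (hg.pderiv _) _ _
    · exact zy_mem_spanZt (hg.X_p_mul _) _ _
    · exact zy_mem_spanZt hg _ _
    · exact zy'_mem_spanZt hg _ _
  · change LamZt _ ∈ spanZt
    rw [LamZt_zy' hg hN]
    refine add_mem (add_mem (add_mem (add_mem (Submodule.smul_mem _ _ (sum_mem fun m _ =>
      Submodule.smul_mem _ _ ?_)) (sum_mem fun m _ => ?_))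
      (Submodule.smul_mem _ _ (Submodule.smul_mem _ _ ?_))) (sum_mem fun m _ => ?_))
      (Submodule.smul_mem _ _ (sum_mem fun m _ => ?_))
    · exact zy'_mem_spanZt (hg.pderiv _) _ _
    · exact zy'_mem_spanZt (hg.X_p_mul _) _ _
    · exact zy'_mem_spanZt hg _ _
    · exact zy_mem_spanZt hg _ _
    · exact zy'_mem_spanZt hg _ _

lemma transfer_LamZt_z {g : R} (hg : IsPFree g) (j : ℕ) :
    transfer (LamZt (X (Var.z j) * g)) = Lam Var.z (transfer (X (Var.z j) * g)) := by
  obtain ⟨N, hN⟩ := exists_bound_pderiv injective_p g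
  rw [LamZt_z hg hN, transfer_z hg, (isLinearMap_Lam injective_z).map_zero]
  simp only [map_add, map_smul, map_sum, transfer_z hg, transfer_z (hg.pderiv _),
    transfer_z (hg.X_p_mul _), smul_zero, Finset.sum_const_zero, add_zero]

lemma transfer_LamZt_zy {g : R} (hg : IsPFree g) (i j : ℕ) :
    transfer (LamZt (X (Var.z j) * (X (Var.y i) * g))) =
      Lam Var.z (transfer (X (Var.z j) * (X (Var.y i) * g))) := by
  obtain ⟨N₀, hN₀⟩ := exists_bound_pderiv injective_p g
  obtain ⟨N, hiN, hN⟩ : ∃ N, i < N ∧ ∀ n ≥ N, pderiv (Var.p n) g = 0 :=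
    ⟨max N₀ (i + 1), by omega, fun n hn => hN₀ n (by omega)⟩
  rw [LamZt_zy hg hN, transfer_zy hg]
  simp only [map_add, map_smul, map_sum, transfer_zy hg, transfer_zy (hg.pderiv _),
    transfer_zy (hg.X_p_mul _), transfer_zy' hg]
  rcases i with _ | i
  · simp [(isLinearMap_Lam injective_z).map_zero]
  simp only [if_neg (Nat.succ_ne_zero i)]
  rw [Lam_X_mul injective_z (hg.X_p_mul _).z (N := N) fun n hn => by
    rw [pderiv_X_mul_of_ne (by simp; omega), hN n hn, mul_zero]]
  have hd (m : ℕ) : pderiv (Var.p (m + 1)) (X (Var.p (i + 1)) * g) =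
      X (Var.p (i + 1)) * pderiv (Var.p (m + 1)) g + if m = i then g else 0 := by
    split_ifs with hm
    · subst hm; simp [add_comm]
    · rw [pderiv_X_mul_of_ne (by simpa using Ne.symm hm), add_zero]
  have hs : ∑ m ∈ Finset.range N, ((m + 1 : ℕ) : K) •
      (X (Var.z (m + j + 1)) * (if m = i then g else 0)) =
      ∑ m ∈ Finset.range (i + 1), X (Var.z (m + j + 1 + (i + 1 - 1 - m))) * g := by
    rw [Finset.sum_eq_single_of_mem i (by simpa using by omega) fun m _ hm => by simp [hm],
      if_pos rfl, Finset.sum_congr rfl fun m hm => by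
        rw [show m + j + 1 + (i + 1 - 1 - m) = i + j + 1 by
          have := Finset.mem_range.1 hm; omega]]
    rw [Finset.sum_const, Finset.card_range, Nat.cast_smul_eq_nsmul]
  simp only [hd, mul_add, smul_add, Finset.sum_add_distrib, hs]
  have hm : ∑ m ∈ Finset.range j, X (Var.z m) * (X (Var.p (i + 1)) * (X (Var.p (j - m)) * g)) =
      ∑ m ∈ Finset.range j, X (Var.z m) * X (Var.p (j - m)) * (X (Var.p (i + 1)) * g) :=
    Finset.sum_congr rfl fun m _ => by ring
  rw [hm]
  abel

lemma transfer_LamZt_zy' {g : R} (hg : IsPFree g) (i j : ℕ) :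
    transfer (LamZt (X (Var.z' j) * (X (Var.y' i) * g))) =
      Lam Var.z (transfer (X (Var.z' j) * (X (Var.y' i) * g))) := by
  obtain ⟨N, hN⟩ := exists_bound_pderiv injective_p g
  rw [LamZt_zy' hg hN, transfer_zy' hg, Lam_X_mul injective_z hg.z hN]
  simp only [map_add, map_smul, map_sum, transfer_zy hg, transfer_zy' (hg.pderiv _),
    transfer_zy' (hg.X_p_mul _), transfer_zy' hg]
  have h1 : ∑ m ∈ Finset.range (i + j), X (Var.z m) * X (Var.p (i + j - m)) * g =
      (∑ m ∈ Finset.range j, X (Var.z (i + m)) * (X (Var.p (j - m)) * g)) +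
      ∑ m ∈ Finset.range i, X (Var.z (i - 1 - m)) *
        ((if m + j + 1 = 0 then 0 else X (Var.p (m + j + 1))) * g) := by
    rw [Finset.sum_range_add, add_comm, ← Finset.sum_range_reflect _ i]
    congr 1 <;> refine Finset.sum_congr rfl fun m hm => ?_
    · rw [show i + j - (i + m) = j - m by omega, mul_assoc]
    · have := Finset.mem_range.1 hm
      rw [if_neg (by omega), show i + j - (i - 1 - m) = m + j + 1 by omega, mul_assoc]
  have h2 : ∑ m ∈ Finset.range i, X (Var.z (m + j + 1 + (i - 1 - m))) * g =
      (i : K) • (X (Var.z (i + j)) * g) := by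
    rw [Finset.sum_congr rfl fun m hm => by
      rw [show m + j + 1 + (i - 1 - m) = i + j by have := Finset.mem_range.1 hm; omega]]
    rw [Finset.sum_const, Finset.card_range, Nat.cast_smul_eq_nsmul]
  have h3 (m : ℕ) : i + (m + j + 1) = m + (i + j) + 1 := by omega
  rw [h1, h2, Nat.cast_add, add_smul, smul_add]
  simp only [h3]
  abel

lemma eqOn_spanZt {S T : R →ₗ[K] R}
    (hz : ∀ g, IsPFree g → ∀ j, S (X (Var.z j) * g) = T (X (Var.z j) * g))
    (hzy : ∀ g, IsPFree g → ∀ i j,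
      S (X (Var.z j) * (X (Var.y i) * g)) = T (X (Var.z j) * (X (Var.y i) * g)))
    (hzy' : ∀ g, IsPFree g → ∀ i j,
      S (X (Var.z' j) * (X (Var.y' i) * g)) = T (X (Var.z' j) * (X (Var.y' i) * g)))
    {F : R} (hF : F ∈ spanZt) : S F = T F := by
  refine LinearMap.eqOn_span ?_ hF
  rintro _ ⟨g, hg, ⟨j, rfl⟩ | ⟨i, j, rfl⟩ | ⟨i, j, rfl⟩⟩
  exacts [hz g hg j, hzy g hg i j, hzy' g hg i j]

lemma transfer_LamZt {F : R} (hF : F ∈ spanZt) :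
    transfer (LamZt F) = Lam Var.z (transfer F) :=
  eqOn_spanZt (S := transfer ∘ₗ isLinearMap_LamZt.mk' _)
    (T := (isLinearMap_Lam injective_z).mk' _ ∘ₗ transfer)
    (fun _ hg => transfer_LamZt_z hg) (fun _ hg => transfer_LamZt_zy hg)
    (fun _ hg => transfer_LamZt_zy' hg) hF

lemma prodLuZt_succ (k : ℕ) (u : Fin (k + 1) → K) (F : R) :
    prodLuZt (k + 1) u F = LuZt (u 0) (prodLuZt k (fun i => u i.succ) F) := by
  simp [prodLuZt, List.ofFn_succ]

lemma prodLuZ_succ (k : ℕ) (u : Fin (k + 1) → K) (F : R) :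
    prodLuZ (k + 1) u F = LuZ (u 0) (prodLuZ k (fun i => u i.succ) F) := by
  simp [prodLuZ, List.ofFn_succ]

lemma transfer_prodLuZt {F : R} (hF : F ∈ spanZt) (k : ℕ) (u : Fin k → K) :
    prodLuZt k u F ∈ spanZt ∧ transfer (prodLuZt k u F) = prodLuZ k u (transfer F) := by
  induction k with
  | zero => simpa [prodLuZt, prodLuZ] using hF
  | succ k ih =>
    obtain ⟨hmem, heq⟩ := ih fun i => u i.succ
    rw [prodLuZt_succ, prodLuZ_succ, LuZt, LuZ, ← heq, map_add, map_smul, transfer_LamZt hmem]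
    exact ⟨add_mem (LamZt_mem_spanZt hmem) (Submodule.smul_mem _ _ hmem), rfl⟩

lemma ThZt_eq (f : R) : ThZt f = pderiv (Var.z 0) f + Theta Var.z f +
    ∑ᶠ (i : ℕ) (j : ℕ), X (Var.y (i + j)) * pderiv (Var.y' i) (pderiv (Var.z' j) f) := rfl

lemma ThZt_z_succ {h : R} (hz : ∀ n, pderiv (Var.z n) h = 0) (hz' : ∀ n, pderiv (Var.z' n) h = 0)
    (j : ℕ) : ThZt (X (Var.z (j + 1)) * h) = X (Var.p (j + 1)) * h := by
  rw [ThZt_eq, Theta_X_succ_mul injective_z hz]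
  simp [hz, hz']

lemma Theta_ThZt_Ztplus {F : R} (hF : F ∈ spanZt) :
    Theta Var.y (ThZt (Ztplus F)) = Theta Var.z (Plus Var.z (transfer F)) := by
  refine eqOn_spanZt (S := (isLinearMap_Theta injective_y).mk' _ ∘ₗ isLinearMap_ThZt.mk' _ ∘ₗ
      isLinearMap_Ztplus.mk' _)
    (T := (isLinearMap_Theta injective_z).mk' _ ∘ₗ (isLinearMap_Plus injective_z).mk' _ ∘ₗ
      transfer) ?_ ?_ ?_ hF <;> intro g hg
  · intro j
    change Theta Var.y (ThZt (Ztplus _)) = Theta Var.z (Plus Var.z (transfer _))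
    rw [Ztplus, Plus_X_mul injective_z hg.z, Plus_eq_zero (by simp [hg.z']), add_zero,
      ThZt_z_succ hg.z hg.z', transfer_z hg, (isLinearMap_Plus injective_z).map_zero,
      (isLinearMap_Theta injective_z).map_zero, Theta_eq_zero (hg.X_p_mul _).y]
  · intro i j
    change Theta Var.y (ThZt (Ztplus _)) = Theta Var.z (Plus Var.z (transfer _))
    have hz (n : ℕ) : pderiv (Var.z n) (X (Var.y i) * g) = 0 := by simp [hg.z]
    have hz' (n : ℕ) : pderiv (Var.z' n) (X (Var.y i) * g) = 0 := by simp [hg.z']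
    rw [Ztplus, Plus_X_mul injective_z hz, Plus_eq_zero (by simp [hg.z']), add_zero,
      ThZt_z_succ hz hz', transfer_zy hg, mul_left_comm]
    rcases i with _ | i
    · rw [Theta_X_zero_mul injective_y (hg.X_p_mul _).y, if_pos rfl, zero_mul, mul_zero,
        (isLinearMap_Plus injective_z).map_zero, (isLinearMap_Theta injective_z).map_zero]
    · rw [Theta_X_succ_mul injective_y (hg.X_p_mul _).y, if_neg (Nat.succ_ne_zero i),
        Plus_X_mul injective_z (hg.X_p_mul _).z, Theta_X_succ_mul injective_z (hg.X_p_mul _).z]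
      ring
  · intro i j
    change Theta Var.y (ThZt (Ztplus _)) = Theta Var.z (Plus Var.z (transfer _))
    rw [Ztplus, Plus_eq_zero (a := Var.z) (by simp [hg.z]),
      Plus_X_mul injective_z' (by simp [hg.z']), zero_add, transfer_zy' hg,
      Plus_X_mul injective_z hg.z, Theta_X_succ_mul injective_z hg.z, ThZt_eq,
      Theta_eq_zero (a := Var.z) (by simp [hg.z]),
      contraction_X_mul_X_mul _ injective_y' injective_z' (by simp) hg.y' hg.z',
      ← add_assoc, ← Theta_X_succ_mul injective_y hg.y]
    simp [hg.z]

lemma z_zero_mul_mem_spanZt {f : R} (hf : f ∈ PY) : X (Var.z 0) * f ∈ spanZt := by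
  suffices h : PY ≤ spanZt.comap (LinearMap.mulLeft K (X (Var.z 0))) from h hf
  rw [PY, Submodule.span_le]
  rintro _ (hg | ⟨i, g, hg, rfl⟩)
  · exact z_mem_spanZt (isPFree_of_mem_Psub hg) 0
  · exact zy_mem_spanZt (isPFree_of_mem_Psub hg) i 0

lemma transfer_z_zero_mul {f : R} (hf : f ∈ PY) :
    transfer (X (Var.z 0) * f) = X (Var.z 0) * Theta Var.y f := by
  have hgen : ∀ F ∈ (Psub : Set R) ∪ {g : R | ∃ i : ℕ, ∃ f ∈ (Psub : Set R),
      g = X (Var.y i) * f}, transfer (X (Var.z 0) * F) = X (Var.z 0) * Theta Var.y F := by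
    rintro F (hF | ⟨i, g, hg, rfl⟩)
    · have hF' := isPFree_of_mem_Psub hF
      rw [transfer_z hF', Theta_eq_zero hF'.y, mul_zero]
    · have hg' := isPFree_of_mem_Psub hg
      rw [transfer_zy hg']
      rcases i with _ | i
      · rw [Theta_X_zero_mul injective_y hg'.y, if_pos rfl, zero_mul]
      · rw [Theta_X_succ_mul injective_y hg'.y, if_neg (Nat.succ_ne_zero i)]
  induction hf using Submodule.span_induction with
  | mem F hF => exact hgen F hF
  | zero => rw [(isLinearMap_Theta injective_y).map_zero, mul_zero, map_zero]
  | add F G _ _ hF hG =>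
    rw [(isLinearMap_Theta injective_y).map_add, mul_add, mul_add, map_add, hF, hG]
  | smul c F _ hF =>
    rw [(isLinearMap_Theta injective_y).map_smul, mul_smul_comm, mul_smul_comm, map_smul, hF]

/-- **Intertwining with `Θ_Y`** (second relation of Lemma 4.9 of Chapuy–Dołęga):
`Θ_Y(Ω_Z^{(k)} + □^{(k)}) = Ω_Z^{(k)} Θ_Y` as operators on `𝒫_Y`, where
`Ω_Z^{(k)} + □^{(k)} = (1/(1+b))·T_Z̃` and `Ω_Z^{(k)} = (1/(1+b))·T_Z`. -/
theorem ThetaY_intertwines_TZt (k : ℕ) (hk : 1 ≤ k) (u : Fin k → K) :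
    ∀ f ∈ PY, Theta Var.y (TZt k u f) = TZ k u (Theta Var.y f) := by
  intro f hf
  have hmem := z_zero_mul_mem_spanZt hf
  obtain ⟨hprod, heq⟩ := transfer_prodLuZt (LamZt_mem_spanZt hmem) k u
  rw [TZt, TZ, Theta_ThZt_Ztplus hprod, heq, transfer_LamZt hmem, transfer_z_zero_mul hf]
end
end

section
/- Kernel property: for every f ∈ 𝒫 (a polynomial in the p-variables only), T_Z̃(y_0·f) = T_Z(y_0·f); equivalently, the subspace y_0·𝒫 is contained in the kernel of the operator □^{(k)} := (1/(1+b))·(T_Z̃ − T_Z). -/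
open MvPolynomial

noncomputable section

/-- Polynomials in the variables `p` and `y₀` only, described by vanishing derivatives. -/
def coeffAlg : Subalgebra K R where
  carrier := {c | ∀ v ∉ insert (Var.y 0) (Set.range Var.p), pderiv v c = 0}
  mul_mem' {a c} ha hc v hv := by simp [ha v hv, hc v hv]
  add_mem' {a c} ha hc v hv := by simp [ha v hv, hc v hv]
  algebraMap_mem' r v _ := by simp [algebraMap_eq]

/-- Polynomials in `p`, `y₀` and `z` that are affine-linear in the variables `z`. -/
def zAffine : Submodule K R where
  carrier := {g | (∀ v ∉ insert (Var.y 0) (Set.range Var.p ∪ Set.range Var.z), pderiv v g = 0) ∧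
    ∀ j, pderiv (Var.z j) g ∈ coeffAlg}
  add_mem' {a c} ha hc := ⟨fun v hv => by simp [ha.1 v hv, hc.1 v hv],
    fun j => by simpa using add_mem (ha.2 j) (hc.2 j)⟩
  zero_mem' := ⟨by simp, by simp⟩
  smul_mem' r a ha := ⟨fun v hv => by simp [ha.1 v hv],
    fun j => by simpa using Subalgebra.smul_mem _ (ha.2 j) r⟩

theorem finsum_mem_submodule {ι : Type*} (V : Submodule K R) {F : ι → R} (h : ∀ i, F i ∈ V) :
    ∑ᶠ i, F i ∈ V :=
  finsum_induction (· ∈ V) V.zero_mem (fun _ _ => V.add_mem) h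

theorem X_p_mem_coeffAlg (i : ℕ) : (X (Var.p i) : R) ∈ coeffAlg := fun v hv =>
  pderiv_X_of_ne fun h => hv (by simp [← h])

theorem X_y_zero_mem_coeffAlg : (X (Var.y 0) : R) ∈ coeffAlg := fun v hv =>
  pderiv_X_of_ne fun h => hv (by simp [← h])

theorem pderiv_pderiv_comm (v w : Var) (g : R) :
    pderiv v (pderiv w g) = pderiv w (pderiv v g) := by
  classical
  induction g using MvPolynomial.induction_on with
  | C r => simp
  | add f g hf hg => simp [hf, hg]
  | mul_X f i hf =>
    have h (s t : Var) : pderiv s (pderiv t (X i : R)) = 0 := by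
      rw [pderiv_X, Pi.single_apply]
      split_ifs <;> simp
    simp only [pderiv_mul, map_add, h, hf]
    ring

theorem pderiv_mem_coeffAlg (w : Var) {c : R} (hc : c ∈ coeffAlg) : pderiv w c ∈ coeffAlg :=
  fun v hv => by rw [pderiv_pderiv_comm, hc v hv, map_zero]

theorem Psub_le_coeffAlg : Psub ≤ coeffAlg := fun _ hf _ hv =>
  pderiv_eq_zero_of_notMem_vars fun h =>
    hv (Set.mem_insert_of_mem _ (mem_supported.1 hf h))

theorem X_z_mul_mem_zAffine (i : ℕ) {c : R} (hc : c ∈ coeffAlg) :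
    X (Var.z i) * c ∈ zAffine := by
  refine ⟨fun v hv => ?_, fun j => ?_⟩
  · have hz : pderiv v (X (Var.z i) : R) = 0 := pderiv_X_of_ne fun h => hv (by simp [← h])
    rw [pderiv_mul, hz, hc v fun h => hv (Set.insert_subset_insert Set.subset_union_left h)]
    simp
  · rw [pderiv_mul, hc (Var.z j) (by simp), mul_zero, add_zero, pderiv_X]
    refine mul_mem ?_ hc
    by_cases h : Var.z j = Var.z i
    · rw [h, Pi.single_eq_same]; exact one_mem _
    · rw [Pi.single_eq_of_ne (by simpa [eq_comm] using h)]; exact zero_mem _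

theorem Lam_z_mem_zAffine {g : R} (hg : g ∈ zAffine) : Lam Var.z g ∈ zAffine := by
  refine add_mem (add_mem (Submodule.smul_mem _ _ ?_) ?_) (Submodule.smul_mem _ _ ?_)
  · exact finsum_mem_submodule _ fun i => finsum_mem_submodule _ fun j =>
      Submodule.smul_mem _ _ (X_z_mul_mem_zAffine _ (pderiv_mem_coeffAlg _ (hg.2 j)))
  · refine finsum_mem_submodule _ fun i => finsum_mem_submodule _ fun j => ?_
    rw [mul_assoc]
    exact X_z_mul_mem_zAffine _ (mul_mem (X_p_mem_coeffAlg _) (hg.2 _))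
  · exact finsum_mem_submodule _ fun i =>
      Submodule.smul_mem _ _ (X_z_mul_mem_zAffine _ (hg.2 _))

theorem Plus_z_mem_zAffine {g : R} (hg : g ∈ zAffine) : Plus Var.z g ∈ zAffine :=
  finsum_mem_submodule _ fun i => X_z_mul_mem_zAffine _ (hg.2 i)

theorem pderiv_y_succ_of_mem_zAffine {g : R} (hg : g ∈ zAffine) (i : ℕ) :
    pderiv (Var.y (i + 1)) g = 0 :=
  hg.1 _ (by simp)

theorem pderiv_y'_of_mem_zAffine {g : R} (hg : g ∈ zAffine) (i : ℕ) :
    pderiv (Var.y' i) g = 0 :=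
  hg.1 _ (by simp)

theorem pderiv_z'_of_mem_zAffine {g : R} (hg : g ∈ zAffine) (i : ℕ) :
    pderiv (Var.z' i) g = 0 :=
  hg.1 _ (by simp)

theorem LamZt_eq_of_mem_zAffine {g : R} (hg : g ∈ zAffine) : LamZt g = Lam Var.z g := by
  have hy (i k j : ℕ) : pderiv (Var.y (i + k + 1)) (pderiv (Var.z j) g) = 0 := by
    rw [pderiv_pderiv_comm, pderiv_y_succ_of_mem_zAffine hg, map_zero]
  simp [LamZt, MZ, Lam.eq_1 Var.z', hy, pderiv_z'_of_mem_zAffine hg]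

theorem Ztplus_eq_of_mem_zAffine {g : R} (hg : g ∈ zAffine) : Ztplus g = Plus Var.z g := by
  simp [Ztplus, Plus.eq_1 Var.z', pderiv_z'_of_mem_zAffine hg]

theorem pderiv_z_zero_Plus_of_mem_zAffine {g : R} (hg : g ∈ zAffine) :
    pderiv (Var.z 0) (Plus Var.z g) = 0 := by
  refine finsum_induction (fun h : R => pderiv (Var.z 0) h = 0) (map_zero _)
    (fun a c ha hc => by simp [ha, hc]) fun i => ?_
  rw [pderiv_mul, pderiv_X_of_ne (by simp), hg.2 i (Var.z 0) (by simp), zero_mul, mul_zero,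
    add_zero]

theorem ThZt_Plus_of_mem_zAffine {g : R} (hg : g ∈ zAffine) :
    ThZt (Plus Var.z g) = Theta Var.z (Plus Var.z g) := by
  simp [ThZt, Theta, pderiv_z_zero_Plus_of_mem_zAffine hg,
    pderiv_z'_of_mem_zAffine (Plus_z_mem_zAffine hg)]

theorem foldr_LuZt_eq_of_mem_zAffine (l : List K) {g : R} (hg : g ∈ zAffine) :
    (l.map LuZt).foldr (fun g h => g ∘ h) id g = (l.map LuZ).foldr (fun g h => g ∘ h) id g ∧
      (l.map LuZ).foldr (fun g h => g ∘ h) id g ∈ zAffine := by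
  induction l with
  | nil => exact ⟨rfl, hg⟩
  | cons u l ih =>
    simp only [List.map_cons, List.foldr_cons, Function.comp_apply]
    refine ⟨?_, add_mem (Lam_z_mem_zAffine ih.2) (Submodule.smul_mem _ _ ih.2)⟩
    rw [ih.1, LuZt, LuZ, LamZt_eq_of_mem_zAffine ih.2]

theorem prodLuZt_eq_of_mem_zAffine (k : ℕ) (u : Fin k → K) {g : R} (hg : g ∈ zAffine) :
    prodLuZt k u g = prodLuZ k u g ∧ prodLuZ k u g ∈ zAffine := by
  simpa only [List.map_ofFn] using! foldr_LuZt_eq_of_mem_zAffine (List.ofFn u) hg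

/-- **Kernel property** (third relation of Lemma 4.9 of Chapuy–Dołęga): for every `f ∈ 𝒫`,
`T_Z̃(y₀·f) = T_Z(y₀·f)`; equivalently, `y₀·𝒫 ⊆ ker □^{(k)}` where
`□^{(k)} = (1/(1+b))·(T_Z̃ − T_Z)`. -/
theorem kernel_property (k : ℕ) (hk : 1 ≤ k) (u : Fin k → K) :
    ∀ f ∈ Psub, TZt k u (X (Var.y 0) * f) = TZ k u (X (Var.y 0) * f) := by
  intro f hf
  have h₀ : X (Var.z 0) * (X (Var.y 0) * f) ∈ zAffine :=
    X_z_mul_mem_zAffine 0 (mul_mem X_y_zero_mem_coeffAlg (Psub_le_coeffAlg hf))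
  obtain ⟨heq, hmem⟩ := prodLuZt_eq_of_mem_zAffine k u (Lam_z_mem_zAffine h₀)
  rw [TZt, TZ, LamZt_eq_of_mem_zAffine h₀, heq, Ztplus_eq_of_mem_zAffine hmem,
    ThZt_Plus_of_mem_zAffine hmem]
end
end
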